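/- arXiv:2104.14249 — 3 statements merged into one kernel-verified Lean document; each statement's English description precedes it below -/
import Mathlib

section
/- Let A be a finite set with #A ≥ 2, let r : A → (0,1), let p = (p_a)_{a∈A} be a probability vector with p_a < 1 for every a, and let 𝔪 be the Bernoulli product measure on A^ℕ with marginal p. Set χ := −Σ_{a∈A} p_a log r_a, h_p := −Σ_{a∈A} p_a log p_a, and k_n := ⌊(−log n)/log(Σ_{a∈A} p_a²)⌋ + 1. Then for every ε > 0 there exists N such that for all n ≥ N there is a set Good(n,ε) ⊆ A^n with: (1) 𝔪(⋃_{a∈Good(n,ε)}[a]) ≥ 7/64; and (2) for each a ∈ Good(n,ε) there is a set W_a ⊆ {0,…,n−k_n} such that (a) #W_a ≥ ⌊n/20⌋, (b) if l, l' ∈ W_a and l ≠ l' then a_{l+1}⋯a_{l+k_n} ≠ a_{l'+1}⋯a_{l'+k_n}, and (c) for each l ∈ W_a, ∏_{i=1}^{k_n} r_{a_{l+i}} ∈ [e^{k_n(−χ−ε)}, e^{k_n(−χ+ε)}] and ∏_{i=1}^{k_n} p_{a_{l+i}} ∈ [e^{k_n(−h_p−ε)}, e^{k_n(−h_p+ε)}].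 -/
open MeasureTheory Filter Set
open scoped ENNReal

noncomputable section

/-- `k_n = ⌊(−log n)/log(Σ_{a∈A} p_a²)⌋ + 1`. -/
def knp {A : Type*} [Fintype A] (p : A → ℝ) (n : ℕ) : ℕ :=
  (⌊(-Real.log n) / Real.log (∑ a, p a ^ 2)⌋).toNat + 1

open ProbabilityTheory

section Windows

variable {A : Type*}

theorem DependsOn.eq_preimage_image {F : Set (ℕ → A)} {S : Finset ℕ}
    (hF : DependsOn (fun σ => σ ∈ F) (S : Set ℕ)) :
    F = (fun (σ : ℕ → A) (i : S) => σ i) ⁻¹' ((fun (σ : ℕ → A) (i : S) => σ i) '' F) := by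
  refine Set.Subset.antisymm (Set.subset_preimage_image _ _) ?_
  rintro σ ⟨τ, hτ, hτσ⟩
  have : (τ ∈ F) = (σ ∈ F) := hF fun i hi => congrFun hτσ ⟨i, hi⟩
  exact this ▸ hτ

/-- Adding a letter constraint at `j` to an event depending on the letters in `S`. -/
theorem DependsOn.inter_coord {F : Set (ℕ → A)} {S : Finset ℕ}
    (hF : DependsOn (fun σ => σ ∈ F) (S : Set ℕ)) (j : ℕ) (a : A) :
    DependsOn (fun σ => σ ∈ F ∩ {σ | σ j = a}) ((insert j S : Finset ℕ) : Set ℕ) := by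
  intro σ τ h
  have h1 : (σ ∈ F) = (τ ∈ F) := hF fun i hi => h i (by simp_all)
  have h2 : σ j = τ j := h j (by simp)
  simp_all

/-- The event that the windows of length `k` at `l` and `l'` carry the same word. -/
def windowsAgree (A : Type*) (k l l' : ℕ) : Set (ℕ → A) :=
  {σ | ∀ i < k, σ (l + i) = σ (l' + i)}

theorem windowsAgree_succ (k l l' : ℕ) :
    windowsAgree A (k + 1) l l' =
      ⋃ a, windowsAgree A k l l' ∩ {σ | σ (l + k) = a} ∩ {σ | σ (l' + k) = a} := by
  ext σ
  simp only [windowsAgree, Set.mem_ofPred_eq, Set.mem_iUnion, Set.mem_inter_iff,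
    Nat.forall_lt_succ_right]
  simp [eq_comm]

theorem dependsOn_windowsAgree (k l l' : ℕ) :
    DependsOn (fun σ => σ ∈ windowsAgree A k l l')
      ((Finset.Ico l (l + k) ∪ Finset.Ico l' (l' + k) : Finset ℕ) : Set ℕ) := by
  intro σ τ h
  have h1 : ∀ i < k, σ (l + i) = τ (l + i) := fun i hi => h _ (by simp; omega)
  have h2 : ∀ i < k, σ (l' + i) = τ (l' + i) := fun i hi => h _ (by simp; omega)
  simp only [windowsAgree, Set.mem_ofPred_eq, eq_iff_iff]
  exact forall₂_congr fun i hi => by rw [h1 i hi, h2 i hi]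

/-- The event that the product of `q` over the window of length `k` at `l` is
`exp (k (c ± ε))`. -/
def normalWindow (q : A → ℝ) (c ε : ℝ) (k l : ℕ) : Set (ℕ → A) :=
  {σ | ∏ i ∈ Finset.range k, q (σ (l + i)) ∈
    Set.Icc (Real.exp (k * (c - ε))) (Real.exp (k * (c + ε)))}

theorem dependsOn_normalWindow (q : A → ℝ) (c ε : ℝ) (k l : ℕ) :
    DependsOn (fun σ => σ ∈ normalWindow q c ε k l) (Finset.Ico l (l + k) : Set ℕ) := by
  intro σ τ h
  have : ∏ i ∈ Finset.range k, q (σ (l + i)) = ∏ i ∈ Finset.range k, q (τ (l + i)) :=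
    Finset.prod_congr rfl fun i hi => by
      rw [h (l + i) (by simpa using hi)]
  simp only [normalWindow, Set.mem_ofPred_eq, this]

end Windows

section Bernoulli

variable {A : Type*} [Fintype A] [MeasurableSpace A] [MeasurableSingletonClass A]
  {p : A → ℝ} {𝔪 : Measure (ℕ → A)}

/-- A measure on sequences with Bernoulli cylinder probabilities is an infinite product. -/
theorem eq_infinitePi_of_cylinder (μ : Measure A) [IsProbabilityMeasure μ]
    (h : ∀ (n : ℕ) (a : Fin n → A),
      𝔪 {σ : ℕ → A | ∀ i : Fin n, σ i = a i} = ∏ i, μ {a i}) :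
    𝔪 = Measure.infinitePi fun _ : ℕ => μ := by
  refine Measure.eq_infinitePi _ fun s t ht => ?_
  obtain ⟨n, hn⟩ : ∃ n, s ⊆ Finset.range n := s.exists_nat_subset_range
  have hm : Measurable fun (σ : ℕ → A) (i : Fin n) => σ i := by fun_prop
  have hmap : 𝔪.map (fun (σ : ℕ → A) (i : Fin n) => σ i) = Measure.pi fun _ : Fin n => μ := by
    refine Measure.ext_of_singleton fun a => ?_
    rw [Measure.map_apply hm (measurableSet_singleton a), Measure.pi_singleton, ← h n a]
    congr 1
    ext σ
    simp [funext_iff]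
  have hpre : (s : Set ℕ).pi t = (fun (σ : ℕ → A) (i : Fin n) => σ i) ⁻¹'
      Set.univ.pi fun i : Fin n => if (i : ℕ) ∈ s then t i else Set.univ := by
    ext σ
    simp only [Set.mem_pi, Finset.mem_coe, Set.mem_preimage, Set.mem_univ, forall_const]
    constructor
    · intro hσ i
      split_ifs with hi
      · exact hσ i hi
      · trivial
    · intro hσ i hi
      have := hσ ⟨i, Finset.mem_range.mp (hn hi)⟩
      simpa [hi] using this
  rw [hpre, ← Measure.map_apply hm
    (MeasurableSet.univ_pi fun i => by split_ifs <;> simp [ht]), hmap, Measure.pi_pi,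
    Fin.prod_univ_eq_prod_range (fun i => μ (if i ∈ s then t i else Set.univ)) n,
    ← Finset.prod_subset hn]
  · exact Finset.prod_congr rfl fun i hi => by simp [hi]
  · intro i _ hi
    simp [hi]

/-- The coordinates of a Bernoulli measure are independent. -/
theorem iIndepFun_of_cylinder
    (h : ∀ (n : ℕ) (a : Fin n → A),
      𝔪 {σ : ℕ → A | ∀ i : Fin n, σ i = a i} = ENNReal.ofReal (∏ i, p (a i)))
    (hp0 : ∀ a, 0 ≤ p a) (hpsum : ∑ a, p a = 1) :
    iIndepFun (fun (i : ℕ) (σ : ℕ → A) => σ i) 𝔪 ∧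
      ∀ i a, 𝔪 {σ | σ i = a} = ENNReal.ofReal (p a) := by
  classical
  let μ : Measure A := (PMF.ofFintype (fun a => ENNReal.ofReal (p a)) (by
    rw [← ENNReal.ofReal_sum_of_nonneg fun a _ => hp0 a, hpsum, ENNReal.ofReal_one])).toMeasure
  have hμ (a : A) : μ {a} = ENNReal.ofReal (p a) := by
    simp [μ]
  have h𝔪 : 𝔪 = Measure.infinitePi fun _ : ℕ => μ :=
    eq_infinitePi_of_cylinder μ fun n a => by
      rw [h, ENNReal.ofReal_prod_of_nonneg fun i _ => hp0 _]
      simp [hμ]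
  subst h𝔪
  refine ⟨iIndepFun_infinitePi (X := fun _ a => a) fun _ => measurable_id, fun i a => ?_⟩
  have := congrArg (fun ν => ν {a}) (Measure.infinitePi_map_eval (fun _ : ℕ => μ) i)
  rw [← hμ a, ← this, Measure.map_apply (by fun_prop) (measurableSet_singleton a)]
  rfl

/-- An event depending on finitely many letters is measurable. -/
theorem DependsOn.measurableSet {F : Set (ℕ → A)} {S : Finset ℕ}
    (hF : DependsOn (fun σ => σ ∈ F) (S : Set ℕ)) : MeasurableSet F := by
  rw [hF.eq_preimage_image]
  exact (Set.toFinite _).measurableSet.preimage (by fun_prop)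

/-- An event depending on finitely many letters is independent of any other letter. -/
theorem measure_inter_coord (hind : iIndepFun (fun (i : ℕ) (σ : ℕ → A) => σ i) 𝔪)
    (hlaw : ∀ i a, 𝔪 {σ | σ i = a} = ENNReal.ofReal (p a)) {F : Set (ℕ → A)} {S : Finset ℕ}
    (hF : DependsOn (fun σ => σ ∈ F) (S : Set ℕ)) {j : ℕ} (hj : j ∉ S) (a : A) :
    𝔪 (F ∩ {σ | σ j = a}) = 𝔪 F * ENNReal.ofReal (p a) := by
  have hjpre : {σ : ℕ → A | σ j = a} = (fun (σ : ℕ → A) (i : ({j} : Finset ℕ)) => σ i) ⁻¹'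
      {f | f ⟨j, Finset.mem_singleton_self j⟩ = a} := rfl
  have hI := hind.indepFun_finset S {j} (by simpa using hj) fun i => measurable_pi_apply i
  have := hI.measure_inter_preimage_eq_mul ((fun (σ : ℕ → A) (i : S) => σ i) '' F)
    {f | f ⟨j, Finset.mem_singleton_self j⟩ = a}
    (Set.toFinite _).measurableSet (Set.toFinite _).measurableSet
  rw [← hF.eq_preimage_image, ← hjpre, hlaw] at this
  exact this

theorem measure_windowsAgree_succ_le (hind : iIndepFun (fun (i : ℕ) (σ : ℕ → A) => σ i) 𝔪)
    (hlaw : ∀ i a, 𝔪 {σ | σ i = a} = ENNReal.ofReal (p a)) {k l l' : ℕ} (hl : l < l') :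
    𝔪 (windowsAgree A (k + 1) l l') ≤
      ∑ a, 𝔪 (windowsAgree A k l l' ∩ {σ | σ (l + k) = a}) * ENNReal.ofReal (p a) := by
  rw [windowsAgree_succ]
  refine (measure_iUnion_fintype_le _ _).trans (Finset.sum_le_sum fun a _ => le_of_eq ?_)
  exact measure_inter_coord hind hlaw ((dependsOn_windowsAgree k l l').inter_coord (l + k) a)
    (by simp; omega) a

/-- Two distinct windows agree with probability at most `M ^ k` if all letters have
probability at most `M`. -/
theorem measure_windowsAgree_le_pow (hind : iIndepFun (fun (i : ℕ) (σ : ℕ → A) => σ i) 𝔪)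
    (hlaw : ∀ i a, 𝔪 {σ | σ i = a} = ENNReal.ofReal (p a)) {M : ℝ} (hM : ∀ a, p a ≤ M)
    {l l' : ℕ} (hl : l < l') (k : ℕ) :
    𝔪 (windowsAgree A k l l') ≤ ENNReal.ofReal M ^ k := by
  induction k with
  | zero =>
    have := hind.isProbabilityMeasure
    simpa using prob_le_one
  | succ k ih =>
    have hdisj : Pairwise (Function.onFun Disjoint fun a : A =>
        windowsAgree A k l l' ∩ {σ | σ (l + k) = a}) := by
      intro a b hab
      exact Set.disjoint_left.mpr fun σ h1 h2 => hab (h1.2.symm.trans h2.2)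
    have hcover : ⋃ a, windowsAgree A k l l' ∩ {σ | σ (l + k) = a} = windowsAgree A k l l' := by
      ext σ
      simp
    calc 𝔪 (windowsAgree A (k + 1) l l')
        ≤ ∑ a, 𝔪 (windowsAgree A k l l' ∩ {σ | σ (l + k) = a}) * ENNReal.ofReal (p a) :=
          measure_windowsAgree_succ_le hind hlaw hl
      _ ≤ ∑ a, 𝔪 (windowsAgree A k l l' ∩ {σ | σ (l + k) = a}) * ENNReal.ofReal M := by
          gcongr with a
          exact hM a
      _ = 𝔪 (windowsAgree A k l l') * ENNReal.ofReal M := by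
          rw [← Finset.sum_mul, ← tsum_fintype (L := .unconditional _),
            ← measure_iUnion hdisj fun a =>
              ((dependsOn_windowsAgree k l l').inter_coord (l + k) a).measurableSet, hcover]
      _ ≤ ENNReal.ofReal M ^ (k + 1) := by
          rw [pow_succ]
          gcongr

/-- Two disjoint windows agree with probability at most `(∑ p²) ^ k`. -/
theorem measure_windowsAgree_le_sum_sq_pow
    (hind : iIndepFun (fun (i : ℕ) (σ : ℕ → A) => σ i) 𝔪)
    (hlaw : ∀ i a, 𝔪 {σ | σ i = a} = ENNReal.ofReal (p a)) (hp0 : ∀ a, 0 ≤ p a)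
    {l l' k : ℕ} (hl : l < l') (hk : l + k ≤ l') :
    𝔪 (windowsAgree A k l l') ≤ ENNReal.ofReal (∑ a, p a ^ 2) ^ k := by
  induction k with
  | zero =>
    have := hind.isProbabilityMeasure
    simpa using prob_le_one
  | succ k ih =>
    calc 𝔪 (windowsAgree A (k + 1) l l')
        ≤ ∑ a, 𝔪 (windowsAgree A k l l' ∩ {σ | σ (l + k) = a}) * ENNReal.ofReal (p a) :=
          measure_windowsAgree_succ_le hind hlaw hl
      _ = ∑ a, 𝔪 (windowsAgree A k l l') * ENNReal.ofReal (p a ^ 2) := by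
          refine Finset.sum_congr rfl fun a _ => ?_
          rw [measure_inter_coord hind hlaw (dependsOn_windowsAgree k l l') (by simp; omega),
            mul_assoc, ← ENNReal.ofReal_mul (hp0 a), sq]
      _ = 𝔪 (windowsAgree A k l l') * ENNReal.ofReal (∑ a, p a ^ 2) := by
          rw [← Finset.mul_sum, ENNReal.ofReal_sum_of_nonneg fun a _ => sq_nonneg _]
      _ ≤ ENNReal.ofReal (∑ a, p a ^ 2) ^ (k + 1) := by
          rw [pow_succ]
          gcongr
          exact ih (by omega)

/-- Chebyshev's inequality for additive functions of a window, uniformly in its position. -/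
theorem exists_measure_window_deviation_le
    (hind : iIndepFun (fun (i : ℕ) (σ : ℕ → A) => σ i) 𝔪)
    (hlaw : ∀ i a, 𝔪 {σ | σ i = a} = ENNReal.ofReal (p a)) (hp0 : ∀ a, 0 ≤ p a) (f : A → ℝ) :
    ∃ v : ℝ, ∀ ε > 0, ∀ k > 0, ∀ l,
      𝔪 {σ | k * ε ≤ |∑ i ∈ Finset.range k, f (σ (l + i)) - k * ∑ a, p a * f a|} ≤
        ENNReal.ofReal (v / (k * ε ^ 2)) := by
  have := hind.isProbabilityMeasure
  let μ := 𝔪.map fun σ => σ 0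
  have hev (i : ℕ) : AEMeasurable (fun σ : ℕ → A => σ i) 𝔪 := (measurable_pi_apply i).aemeasurable
  have : IsProbabilityMeasure μ := Measure.isProbabilityMeasure_map (hev 0)
  have hμ (i : ℕ) : 𝔪.map (fun σ => σ i) = μ := by
    refine Measure.ext_of_singleton fun a => ?_
    have h1 := hlaw i a
    have h2 := hlaw 0 a
    rw [Measure.map_apply (by fun_prop) (measurableSet_singleton a),
      Measure.map_apply (by fun_prop) (measurableSet_singleton a)]
    exact h1.trans h2.symm
  have hf : Measurable f := measurable_of_finite f
  have hmem (i : ℕ) : MemLp (fun σ : ℕ → A => f (σ i)) 2 𝔪 := by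
    have : MemLp f 2 (𝔪.map fun σ => σ i) := by
      rw [hμ]
      exact .of_discrete
    exact this.comp_of_map (hev i)
  have hint (i : ℕ) : ∫ σ, f (σ i) ∂𝔪 = ∑ a, p a * f a := by
    rw [← integral_map (φ := fun σ : ℕ → A => σ i) (hev i) hf.aestronglyMeasurable,
      integral_fintype .of_finite]
    refine Finset.sum_congr rfl fun a _ => ?_
    rw [map_measureReal_apply (by fun_prop) (measurableSet_singleton a), measureReal_def]
    have h1 := hlaw i a
    rw [show (fun σ : ℕ → A => σ i) ⁻¹' {a} = {σ | σ i = a} from rfl, h1,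
      ENNReal.toReal_ofReal (hp0 a), smul_eq_mul]
  have hvar (i : ℕ) : Var[fun σ : ℕ → A => f (σ i); 𝔪] = Var[f; μ] := by
    rw [← hμ i, variance_map hf.aemeasurable (hev i)]
    rfl
  refine ⟨Var[f; μ], fun ε hε k hk l => ?_⟩
  have hk' : (0 : ℝ) < k := by exact_mod_cast hk
  have hsum : MemLp (∑ i ∈ Finset.range k, fun σ : ℕ → A => f (σ (l + i))) 2 𝔪 :=
    memLp_finsetSum' _ fun i _ => hmem _
  have hE : 𝔪[∑ i ∈ Finset.range k, fun σ : ℕ → A => f (σ (l + i))] = k * ∑ a, p a * f a := by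
    simp only [Finset.sum_apply]
    rw [integral_finsetSum _ fun i _ => (hmem _).integrable (by norm_num)]
    simp [hint]
  have hV : Var[∑ i ∈ Finset.range k, fun σ : ℕ → A => f (σ (l + i)); 𝔪] = k * Var[f; μ] := by
    rw [IndepFun.variance_sum fun i _ => hmem _]
    · simp [hvar]
    · intro i _ j _ hij
      exact (hind.indepFun (show l + i ≠ l + j by omega)).comp hf hf
  have := meas_ge_le_variance_div_sq hsum (mul_pos hk' hε)
  rw [hE, hV] at this
  simp only [Finset.sum_apply] at this
  convert this using 2
  field_simp

/-- Windows fail to be normal with probability `O(1 / k)`, uniformly in their position. -/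
theorem exists_measure_compl_normalWindow_le
    (hind : iIndepFun (fun (i : ℕ) (σ : ℕ → A) => σ i) 𝔪)
    (hlaw : ∀ i a, 𝔪 {σ | σ i = a} = ENNReal.ofReal (p a)) (hp0 : ∀ a, 0 ≤ p a)
    {q : A → ℝ} (hq : ∀ a, p a ≠ 0 → 0 < q a) {ε : ℝ} (hε : 0 < ε) :
    ∃ v : ℝ, ∀ k > 0, ∀ l,
      𝔪 (normalWindow q (∑ a, p a * Real.log (q a)) ε k l)ᶜ ≤ ENNReal.ofReal (v / k) := by
  obtain ⟨v, hv⟩ := exists_measure_window_deviation_le hind hlaw hp0 fun a => Real.log (q a)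
  refine ⟨v / ε ^ 2, fun k hk l => ?_⟩
  have hpos : ∀ᵐ σ ∂𝔪, ∀ i, 0 < q (σ i) := by
    refine ae_all_iff.mpr fun i => ?_
    have hne : ∀ a, p a = 0 → ∀ᵐ σ ∂𝔪, σ i ≠ a := fun a ha => by
      simpa [ae_iff, ha] using hlaw i a
    have : ∀ᵐ σ ∂𝔪, ∀ a, p a = 0 → σ i ≠ a := by
      refine ae_all_iff.mpr fun a => ?_
      by_cases ha : p a = 0
      · filter_upwards [hne a ha] with σ hσ _ using hσ
      · filter_upwards with σ h using absurd h ha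
    filter_upwards [this] with σ hσ
    exact hq _ fun h => hσ _ h rfl
  have hle := hv ε hε k hk l
  rw [show v / (k * ε ^ 2) = v / ε ^ 2 / k by rw [div_div, mul_comm]] at hle
  refine (measure_mono_ae ?_).trans hle
  filter_upwards [hpos] with σ hσ hnot
  by_contra hdev
  refine hnot ?_
  replace hdev := abs_lt.mp (not_le.mp hdev)
  have hexp : ∏ i ∈ Finset.range k, q (σ (l + i)) =
      Real.exp (∑ i ∈ Finset.range k, Real.log (q (σ (l + i)))) := by
    rw [Real.exp_sum]
    exact Finset.prod_congr rfl fun i _ => (Real.exp_log (hσ _)).symm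
  simp only [normalWindow, Set.mem_ofPred_eq, hexp, Set.mem_Icc, Real.exp_le_exp]
  constructor <;> nlinarith [hdev.1, hdev.2]

/-- The expected number of earlier windows that agree with the one at `l`. -/
theorem sum_measure_windowsAgree_le
    (hind : iIndepFun (fun (i : ℕ) (σ : ℕ → A) => σ i) 𝔪)
    (hlaw : ∀ i a, 𝔪 {σ | σ i = a} = ENNReal.ofReal (p a)) (hp0 : ∀ a, 0 ≤ p a)
    {M : ℝ} (hM : ∀ a, p a ≤ M) (k l : ℕ) :
    ∑ l' ∈ Finset.range l, 𝔪 (windowsAgree A k l' l) ≤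
      k * ENNReal.ofReal M ^ k + l * ENNReal.ofReal (∑ a, p a ^ 2) ^ k := by
  calc ∑ l' ∈ Finset.range l, 𝔪 (windowsAgree A k l' l)
      ≤ ∑ l' ∈ Finset.range l, ((if l < l' + k then ENNReal.ofReal M ^ k else 0) +
          ENNReal.ofReal (∑ a, p a ^ 2) ^ k) := by
        refine Finset.sum_le_sum fun l' hl' => ?_
        have hlt := Finset.mem_range.mp hl'
        split_ifs with h
        · exact (measure_windowsAgree_le_pow hind hlaw hM hlt k).trans le_self_add
        · rw [zero_add]
          exact measure_windowsAgree_le_sum_sq_pow hind hlaw hp0 hlt (not_lt.mp h)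
    _ ≤ k * ENNReal.ofReal M ^ k + l * ENNReal.ofReal (∑ a, p a ^ 2) ^ k := by
        rw [Finset.sum_add_distrib, ← Finset.sum_filter, Finset.sum_const, Finset.sum_const,
          Finset.card_range, nsmul_eq_mul, nsmul_eq_mul]
        gcongr
        have hsub : {l' ∈ Finset.range l | l < l' + k} ⊆ Finset.Ico (l - k) l := by
          intro l' hl'
          simp only [Finset.mem_filter, Finset.mem_range, Finset.mem_Ico] at hl' ⊢
          omega
        refine (Finset.card_le_card hsub).trans ?_
        simp only [Nat.card_Ico]
        omega

end Bernoulli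

section Selection

open scoped Classical in
/-- The positions `l < m` at which `G l` holds and that are not related by `E` to any earlier
position. -/
def freshPositions {Ω : Type*} (G : ℕ → Set Ω) (E : ℕ → ℕ → Set Ω) (m : ℕ) (ω : Ω) : Finset ℕ :=
  {l ∈ Finset.range m | ω ∈ G l ∧ ∀ l' < l, ω ∉ E l' l}

theorem mem_freshPositions {Ω : Type*} {G : ℕ → Set Ω} {E : ℕ → ℕ → Set Ω} {m : ℕ} {ω : Ω}
    {l : ℕ} :
    l ∈ freshPositions G E m ω ↔ l < m ∧ ω ∈ G l ∧ ∀ l' < l, ω ∉ E l' l := by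
  simp [freshPositions]

/-- A first moment bound for the number of positions that are not fresh. -/
theorem mul_measure_card_freshPositions_lt_le {Ω : Type*} [MeasurableSpace Ω] {P : Measure Ω}
    {G : ℕ → Set Ω} {E : ℕ → ℕ → Set Ω} (hG : ∀ l, MeasurableSet (G l))
    (hE : ∀ l l', MeasurableSet (E l l')) {m : ℕ} {δ : ℝ≥0∞}
    (hδ : ∀ l < m, P (G l)ᶜ + ∑ l' ∈ Finset.range l, P (E l' l) ≤ δ) (t : ℕ) :
    ((m - t : ℕ) : ℝ≥0∞) * P {ω | (freshPositions G E m ω).card < t} ≤ m * δ := by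
  classical
  let f (l : ℕ) (ω : Ω) : ℝ≥0∞ :=
    (G l)ᶜ.indicator 1 ω + ∑ l' ∈ Finset.range l, (E l' l).indicator 1 ω
  have hfm (l : ℕ) : Measurable (f l) := by
    refine (measurable_one.indicator (hG l).compl).add ?_
    exact Finset.measurable_fun_sum _ fun l' _ => measurable_one.indicator (hE l' l)
  have hf (l : ℕ) : ∫⁻ ω, f l ω ∂P = P (G l)ᶜ + ∑ l' ∈ Finset.range l, P (E l' l) := by
    rw [lintegral_add_left (measurable_one.indicator (hG l).compl),
      lintegral_finsetSum _ fun l' _ => measurable_one.indicator (hE l' l),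
      lintegral_indicator_one (hG l).compl]
    simp only [lintegral_indicator_one (hE _ l)]
  have hone (l : ℕ) (ω : Ω) (h : ¬ (ω ∈ G l ∧ ∀ l' < l, ω ∉ E l' l)) : 1 ≤ f l ω := by
    by_cases hGl : ω ∈ G l
    · obtain ⟨l', hl', hω⟩ : ∃ l' < l, ω ∈ E l' l := by simpa [hGl] using h
      refine le_trans ?_ (le_add_self : _ ≤ f l ω)
      refine le_trans ?_ (Finset.single_le_sum (f := fun l' => (E l' l).indicator 1 ω)
        (fun _ _ => zero_le) (Finset.mem_range.mpr hl'))
      simp [hω]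
    · exact le_trans (by simp [hGl]) (le_self_add : _ ≤ f l ω)
  have hsub : {ω | (freshPositions G E m ω).card < t} ⊆
      {ω | ((m - t : ℕ) : ℝ≥0∞) ≤ ∑ l ∈ Finset.range m, f l ω} := by
    intro ω hω
    have hcard := Finset.card_filter_add_card_filter_not (s := Finset.range m)
      (fun l => ω ∈ G l ∧ ∀ l' < l, ω ∉ E l' l)
    set N := {l ∈ Finset.range m | ¬ (ω ∈ G l ∧ ∀ l' < l, ω ∉ E l' l)} with hN
    have hNt : m - t ≤ N.card := by
      simp only [Set.mem_ofPred_eq, freshPositions] at hω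
      simp only [Finset.card_range] at hcard
      omega
    calc ((m - t : ℕ) : ℝ≥0∞) ≤ N.card := by exact_mod_cast hNt
      _ = ∑ l ∈ N, 1 := by simp
      _ ≤ ∑ l ∈ N, f l ω := Finset.sum_le_sum fun l hl => hone l ω (Finset.mem_filter.mp hl).2
      _ ≤ ∑ l ∈ Finset.range m, f l ω :=
        Finset.sum_le_sum_of_subset (Finset.filter_subset _ _)
  calc ((m - t : ℕ) : ℝ≥0∞) * P {ω | (freshPositions G E m ω).card < t}
      ≤ (m - t : ℕ) * P {ω | ((m - t : ℕ) : ℝ≥0∞) ≤ ∑ l ∈ Finset.range m, f l ω} := by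
        gcongr
    _ ≤ ∫⁻ ω, ∑ l ∈ Finset.range m, f l ω ∂P :=
        mul_meas_ge_le_lintegral (Finset.measurable_fun_sum _ fun l _ => hfm l) _
    _ = ∑ l ∈ Finset.range m, (P (G l)ᶜ + ∑ l' ∈ Finset.range l, P (E l' l)) := by
        rw [lintegral_finsetSum _ fun l _ => hfm l]
        exact Finset.sum_congr rfl fun l _ => hf l
    _ ≤ ∑ l ∈ Finset.range m, δ := Finset.sum_le_sum fun l hl => hδ l (Finset.mem_range.mp hl)
    _ = m * δ := by simp

end Selection

section Asymptotics

variable {A : Type*} [Fintype A] {p : A → ℝ}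

theorem tendsto_knp (h0 : 0 < ∑ a, p a ^ 2) (h1 : ∑ a, p a ^ 2 < 1) :
    Tendsto (knp p) atTop atTop := by
  have hlog : Real.log (∑ a, p a ^ 2) < 0 := Real.log_neg h0 h1
  have h : Tendsto (fun n : ℕ => (-Real.log n) / Real.log (∑ a, p a ^ 2)) atTop atTop :=
    (tendsto_neg_atTop_atBot.comp
      (Real.tendsto_log_atTop.comp tendsto_natCast_atTop_atTop)).atBot_mul_const_of_neg
        (inv_lt_zero.mpr hlog)
  refine tendsto_atTop_mono (fun n => ?_) (tendsto_nat_floor_atTop.comp h)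
  simp only [knp, Function.comp_apply, Int.floor_toNat]
  omega

theorem sum_sq_pow_knp_le (h0 : 0 < ∑ a, p a ^ 2) (h1 : ∑ a, p a ^ 2 < 1) {n : ℕ} (hn : 0 < n) :
    (∑ a, p a ^ 2) ^ knp p n ≤ 1 / n := by
  have hlog : Real.log (∑ a, p a ^ 2) < 0 := Real.log_neg h0 h1
  have hn' : (0 : ℝ) < n := by exact_mod_cast hn
  have hk : (-Real.log n) / Real.log (∑ a, p a ^ 2) ≤ knp p n := by
    rw [knp, Int.floor_toNat]
    exact_mod_cast (Nat.lt_floor_add_one _).le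
  rw [← Real.log_le_log_iff (pow_pos h0 _) (by positivity), Real.log_pow, one_div, Real.log_inv]
  rwa [div_le_iff_of_neg hlog] at hk

theorem eventually_half_add_knp_le (h0 : 0 < ∑ a, p a ^ 2) (h1 : ∑ a, p a ^ 2 < 1) :
    ∀ᶠ n in atTop, n / 2 + knp p n ≤ n := by
  have hlog : 0 < -Real.log (∑ a, p a ^ 2) := neg_pos.mpr (Real.log_neg h0 h1)
  have hb := (Real.isLittleO_log_id_atTop.comp_tendsto tendsto_natCast_atTop_atTop).bound
    (show 0 < -Real.log (∑ a, p a ^ 2) / 4 by positivity)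
  filter_upwards [hb, eventually_ge_atTop 4] with n hn hn4
  have hn4' : (4 : ℝ) ≤ n := by exact_mod_cast hn4
  have hfloor : ⌊(-Real.log n) / Real.log (∑ a, p a ^ 2)⌋₊ ≤ n / 4 := by
    have hx : (-Real.log n) / Real.log (∑ a, p a ^ 2) ≤ n / 4 := by
      have := (le_abs_self _).trans hn
      simp only [Function.comp_apply, id_eq, Real.norm_eq_abs, Nat.abs_cast] at this
      rw [← neg_div_neg_eq, neg_neg, div_le_iff₀ hlog]
      linarith
    have hx' : (⌊(-Real.log n) / Real.log (∑ a, p a ^ 2)⌋₊ : ℝ) ≤ n / 4 := by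
      refine (Nat.floor_le ?_).trans hx
      exact div_nonneg_of_nonpos (neg_nonpos.mpr (Real.log_natCast_nonneg n)) (by linarith)
    rw [le_div_iff₀ (by norm_num)] at hx'
    rw [Nat.le_div_iff_mul_le (by norm_num)]
    exact_mod_cast hx'
  rw [knp, Int.floor_toNat]
  omega

end Asymptotics

/-- Lemma 3.3 of the paper: for every `ε > 0` and all sufficiently large
`n` there is a set `Good(n,ε) ⊆ A^n` of words whose cylinders have total `𝔪`-measure at
least `7/64`, and for each `a ∈ Good(n,ε)` a set `W_a ⊆ {0,…,n−k_n}` of at least `⌊n/20⌋`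
positions at which the length-`k_n` windows of `a` are pairwise distinct and have normal
`r`-products and `p`-products. -/
theorem statement15 {A : Type*} [Fintype A] [MeasurableSpace A] [MeasurableSingletonClass A]
    (hA : 2 ≤ Fintype.card A)
    (r : A → ℝ) (hr : ∀ a, r a ∈ Set.Ioo (0 : ℝ) 1)
    (p : A → ℝ) (hp0 : ∀ a, 0 ≤ p a) (hp1 : ∀ a, p a < 1) (hpsum : ∑ a, p a = 1)
    (𝔪 : Measure (ℕ → A)) [IsProbabilityMeasure 𝔪]
    (h𝔪 : ∀ (n : ℕ) (a : Fin n → A),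
      𝔪 {σ : ℕ → A | ∀ i : Fin n, σ i = a i} = ENNReal.ofReal (∏ i, p (a i))) :
    ∀ ε > (0 : ℝ), ∃ N : ℕ, ∀ n ≥ N,
      ∃ (Good : Set (Fin n → A)) (W : (Fin n → A) → Set ℕ),
        (7 : ℝ≥0∞) / 64 ≤ 𝔪 {σ : ℕ → A | ∃ a ∈ Good, ∀ i : Fin n, σ i = a i} ∧
        ∀ a ∈ Good, ∃ hW : ∀ l ∈ W a, l + knp p n ≤ n,
          n / 20 ≤ (W a).ncard ∧
          (∀ l l' (hl : l ∈ W a) (hl' : l' ∈ W a), l ≠ l' →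
            ∃ i, ∃ hi : i < knp p n,
              a ⟨l + i, by have := hW l hl; omega⟩ ≠ a ⟨l' + i, by have := hW l' hl'; omega⟩) ∧
          (∀ l (hl : l ∈ W a),
            (∏ i : Fin (knp p n),
                r (a ⟨l + (i : ℕ), by have := hW l hl; have := i.isLt; omega⟩)) ∈
              Set.Icc (Real.exp (knp p n * (-(-∑ b, p b * Real.log (r b)) - ε)))
                      (Real.exp (knp p n * (-(-∑ b, p b * Real.log (r b)) + ε))) ∧
            (∏ i : Fin (knp p n),
                p (a ⟨l + (i : ℕ), by have := hW l hl; have := i.isLt; omega⟩)) ∈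
              Set.Icc (Real.exp (knp p n * (-(-∑ b, p b * Real.log (p b)) - ε)))
                      (Real.exp (knp p n * (-(-∑ b, p b * Real.log (p b)) + ε)))) := by
  have : Nonempty A := Fintype.card_pos_iff.mp (by omega)
  obtain ⟨hind, hlaw⟩ := iIndepFun_of_cylinder h𝔪 hp0 hpsum
  obtain ⟨b, hb⟩ := Finite.exists_max p
  have hM0 : 0 ≤ p b := hp0 b
  have hpb : 0 < p b := by
    refine lt_of_le_of_ne hM0 fun h => ?_
    have : ∀ a, p a = 0 := fun a => le_antisymm (h ▸ hb a) (hp0 a)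
    simp [this] at hpsum
  have hs0 : 0 < ∑ a, p a ^ 2 :=
    Finset.sum_pos' (fun a _ => sq_nonneg _) ⟨b, Finset.mem_univ b, by positivity⟩
  have hs1 : ∑ a, p a ^ 2 < 1 := by
    refine lt_of_le_of_lt ?_ (hp1 b)
    calc ∑ a, p a ^ 2 ≤ ∑ a, p a * p b := Finset.sum_le_sum fun a _ => by
          rw [sq]
          exact mul_le_mul_of_nonneg_left (hb a) (hp0 a)
      _ = p b := by rw [← Finset.sum_mul, hpsum, one_mul]
  intro ε hε
  obtain ⟨v, hv⟩ := exists_measure_compl_normalWindow_le hind hlaw hp0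
    (fun a _ => (hr a).1) hε
  obtain ⟨w, hw⟩ := exists_measure_compl_normalWindow_le hind hlaw hp0
    (fun a ha => lt_of_le_of_ne (hp0 a) (Ne.symm ha)) hε
  have hkt := tendsto_knp hs0 hs1
  have hsmall : ∀ᶠ n in atTop,
      |v| / knp p n + |w| / knp p n + knp p n * p b ^ knp p n < 3 / 10 := by
    have h1 (u : ℝ) : Tendsto (fun k : ℕ => u / k) atTop (nhds 0) :=
      tendsto_const_div_atTop_nhds_zero_nat u
    have h2 := ((h1 |v|).add (h1 |w|)).add (tendsto_self_mul_const_pow_of_lt_one hM0 (hp1 b))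
    exact (h2.comp hkt).eventually_lt_const (by norm_num)
  obtain ⟨N, hN⟩ := eventually_atTop.mp
    ((hsmall.and (eventually_half_add_knp_le hs0 hs1)).and (eventually_ge_atTop 2))
  refine ⟨N, fun n hn => ?_⟩
  obtain ⟨⟨hδ, hkn⟩, hn2⟩ := hN n hn
  have hkpos : 0 < knp p n := Nat.succ_pos _
  set k := knp p n with hk
  let G (l : ℕ) : Set (ℕ → A) := normalWindow r (∑ a, p a * Real.log (r a)) ε k l ∩
    normalWindow p (∑ a, p a * Real.log (p a)) ε k l
  have hG (l : ℕ) : MeasurableSet (G l) :=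
    (DependsOn.measurableSet (dependsOn_normalWindow _ _ _ _ _)).inter
      (DependsOn.measurableSet (dependsOn_normalWindow _ _ _ _ _))
  have hE (l l' : ℕ) : MeasurableSet (windowsAgree A k l l') :=
    DependsOn.measurableSet (dependsOn_windowsAgree k l l')
  have hbound : ∀ l < n / 2, 𝔪 (G l)ᶜ + ∑ l' ∈ Finset.range l, 𝔪 (windowsAgree A k l' l) ≤
      ENNReal.ofReal (4 / 5) := by
    intro l hl
    have hl2 : (l : ℝ) * (∑ a, p a ^ 2) ^ k ≤ 1 / 2 := by
      have hn' : (0 : ℝ) < n := by exact_mod_cast (by omega : 0 < n)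
      have h2l : (2 : ℝ) * l ≤ n := by exact_mod_cast (by omega : 2 * l ≤ n)
      calc (l : ℝ) * (∑ a, p a ^ 2) ^ k ≤ l * (1 / n) := by
            gcongr
            exact sum_sq_pow_knp_le hs0 hs1 (by omega)
        _ ≤ 1 / 2 := by
            rw [mul_one_div, div_le_div_iff₀ hn' two_pos]
            linarith
    calc 𝔪 (G l)ᶜ + ∑ l' ∈ Finset.range l, 𝔪 (windowsAgree A k l' l)
        ≤ (ENNReal.ofReal (|v| / k) + ENNReal.ofReal (|w| / k)) +
          (k * ENNReal.ofReal (p b) ^ k + l * ENNReal.ofReal (∑ a, p a ^ 2) ^ k) := by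
          refine add_le_add ?_ (sum_measure_windowsAgree_le hind hlaw hp0 hb k l)
          rw [Set.compl_inter]
          refine (measure_union_le _ _).trans (add_le_add ?_ ?_)
          · refine (hv k hkpos l).trans (ENNReal.ofReal_le_ofReal ?_)
            gcongr
            exact le_abs_self v
          · refine (hw k hkpos l).trans (ENNReal.ofReal_le_ofReal ?_)
            gcongr
            exact le_abs_self w
      _ = ENNReal.ofReal (|v| / k + |w| / k + (k * p b ^ k + l * (∑ a, p a ^ 2) ^ k)) := by
          rw [ENNReal.ofReal_add (by positivity) (by positivity),
            ENNReal.ofReal_add (by positivity) (by positivity),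
            ENNReal.ofReal_add (by positivity) (by positivity),
            ENNReal.ofReal_mul (by positivity), ENNReal.ofReal_mul (by positivity),
            ENNReal.ofReal_pow hM0, ENNReal.ofReal_pow hs0.le, ENNReal.ofReal_natCast,
            ENNReal.ofReal_natCast]
      _ ≤ ENNReal.ofReal (4 / 5) := ENNReal.ofReal_le_ofReal (by linarith)
  let F : (ℕ → A) → Finset ℕ := freshPositions G (windowsAgree A k) (n / 2)
  have hfew : 𝔪 {σ | (F σ).card < n / 20} ≤ 57 / 64 := by
    have hmul := mul_measure_card_freshPositions_lt_le hG hE hbound (n / 20)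
    have hreal := ENNReal.toReal_mono (by finiteness) hmul
    rw [ENNReal.toReal_mul, ENNReal.toReal_mul, ENNReal.toReal_natCast, ENNReal.toReal_natCast,
      ENNReal.toReal_ofReal (by norm_num)] at hreal
    have hm : (0 : ℝ) < (n / 2 : ℕ) := by exact_mod_cast (by omega : 0 < n / 2)
    have hmt : (9 : ℝ) * (n / 2 : ℕ) ≤ 10 * (n / 2 - n / 20 : ℕ) := by
      exact_mod_cast (by omega : 9 * (n / 2) ≤ 10 * (n / 2 - n / 20))
    set x := (𝔪 {σ | (F σ).card < n / 20}).toReal with hx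
    have hx0 : 0 ≤ x := ENNReal.toReal_nonneg
    have hx9 : (n / 2 : ℕ) * (9 * x) ≤ (n / 2 : ℕ) * (8 : ℝ) := by
      nlinarith [mul_le_mul_of_nonneg_right hmt hx0]
    have hx8 := le_of_mul_le_mul_left hx9 hm
    refine (ENNReal.toReal_le_toReal (measure_ne_top _ _) (by finiteness)).mp ?_
    rw [← hx, ENNReal.toReal_div, ENNReal.toReal_ofNat, ENNReal.toReal_ofNat]
    linarith
  have hF : DependsOn F (Finset.range n : Set ℕ) := by
    intro σ τ h
    ext l
    simp only [F, mem_freshPositions]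
    refine and_congr_right fun hl => and_congr ?_ (forall₂_congr fun l' hl' => not_congr ?_)
    · refine and_congr (iff_of_eq ?_) (iff_of_eq ?_) <;>
      exact dependsOn_normalWindow _ _ _ _ _ fun i hi => h i (by simp at hi ⊢; omega)
    · exact iff_of_eq (dependsOn_windowsAgree k l' l fun i hi => h i (by simp at hi ⊢; omega))
  let ext (a : Fin n → A) (i : ℕ) : A := if h : i < n then a ⟨i, h⟩ else b
  have hext (a : Fin n → A) {i : ℕ} (hi : i < n) : ext a i = a ⟨i, hi⟩ := dif_pos hi
  refine ⟨{a | n / 20 ≤ (F (ext a)).card}, fun a => F (ext a), ?_, fun a ha => ?_⟩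
  · have hsub : {σ | (F σ).card < n / 20}ᶜ ⊆ {σ : ℕ → A | ∃ a ∈ {a | n / 20 ≤ (F (ext a)).card},
        ∀ i : Fin n, σ i = a i} := by
      intro σ hσ
      refine ⟨fun i => σ i, ?_, fun i => rfl⟩
      have : F (ext fun i => σ i) = F σ := hF fun i hi => hext (fun i => σ i) (by simpa using hi)
      simpa [this] using hσ
    refine le_trans ?_ (measure_mono hsub)
    have hone : (1 : ℝ≥0∞) ≤ 57 / 64 + 𝔪 {σ | (F σ).card < n / 20}ᶜ := by
      calc (1 : ℝ≥0∞) = 𝔪 Set.univ := measure_univ.symm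
        _ ≤ 𝔪 {σ | (F σ).card < n / 20} + 𝔪 {σ | (F σ).card < n / 20}ᶜ := by
          rw [← Set.union_compl_self {σ | (F σ).card < n / 20}]
          exact measure_union_le _ _
        _ ≤ _ := by gcongr
    have h64 : (57 / 64 : ℝ≥0∞) + 7 / 64 = 1 := by
      rw [ENNReal.div_add_div_same]
      norm_num
      exact ENNReal.div_self (by norm_num) (by norm_num)
    rw [← h64] at hone
    exact (ENNReal.add_le_add_iff_left (by finiteness)).mp hone
  · have hlt {l : ℕ} (hl : l ∈ (F (ext a) : Set ℕ)) : l + k ≤ n := by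
      have := (mem_freshPositions.mp hl).1
      omega
    refine ⟨fun l hl => hlt hl, ?_, ?_, fun l hl => ?_⟩
    · simpa using ha
    · have key : ∀ l l', l ∈ (F (ext a) : Set ℕ) → ∀ hl' : l' ∈ (F (ext a) : Set ℕ), l < l' →
          ∃ i < k, ext a (l + i) ≠ ext a (l' + i) := by
        intro l l' _ hl' hll
        have := (mem_freshPositions.mp hl').2.2 l hll
        simpa [windowsAgree] using this
      intro l l' hl hl' hne
      rcases lt_or_gt_of_ne hne with hll | hll
      · obtain ⟨i, hi, hia⟩ := key l l' hl hl' hll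
        have h1 := hlt hl
        have h2 := hlt hl'
        rw [hext a (by omega), hext a (by omega)] at hia
        exact ⟨i, hi, hia⟩
      · obtain ⟨i, hi, hia⟩ := key l' l hl' hl hll
        have h1 := hlt hl
        have h2 := hlt hl'
        rw [hext a (by omega), hext a (by omega)] at hia
        exact ⟨i, hi, hia.symm⟩
    · have hprod (q : A → ℝ) : ∏ i ∈ Finset.range k, q (ext a (l + i)) =
          ∏ i : Fin k, q (a ⟨l + (i : ℕ), by have := hlt hl; have := i.isLt; omega⟩) := by
        rw [← Fin.prod_univ_eq_prod_range (fun i => q (ext a (l + i)))]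
        exact Finset.prod_congr rfl fun i _ => by rw [hext]
      have hGl : ext a ∈ G l := (mem_freshPositions.mp hl).2.1
      rw [neg_neg, neg_neg, ← hprod r, ← hprod p]
      exact hGl
end
end

section
/- Let s > 0 and let g : ℕ → [0,∞) be non-increasing with Σ_{n=1}^∞ n·g(n)^s = ∞. Define g₁ : ℕ → [0,∞) by g₁(n) := min{g(n), n^{−2/s}}. Then Σ_{n=1}^∞ n·g₁(n)^s = ∞. -/
theorem tendsto_sq_mul_of_antitoneOn_of_summable {f : ℕ → ℝ} (hf0 : ∀ n, 0 ≤ f n)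
    (hf : AntitoneOn f (Set.Ici 1)) (hsum : Summable fun n : ℕ => (n : ℝ) * f n) :
    Filter.Tendsto (fun n : ℕ => (n : ℝ) ^ 2 * f n) Filter.atTop (nhds 0) := by
  have hnn : ∀ n : ℕ, 0 ≤ (n : ℝ) * f n := fun n => mul_nonneg n.cast_nonneg (hf0 n)
  rw [Metric.tendsto_atTop]
  intro ε hε
  obtain ⟨K, hK⟩ := (hsum.hasSum.tendsto_sum_nat.eventually
    (lt_mem_nhds (sub_lt_self _ (show 0 < ε / 4 by positivity)))).exists
  refine ⟨2 * K, fun n hn => ?_⟩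
  have hKn : K ≤ n + 1 := by lia
  have hgauss : ∀ m, K ≤ m →
      ∑ k ∈ Finset.Ico K m, (k : ℝ) = ((m : ℝ) * (m - 1) - K * (K - 1)) / 2 := by
    intro m hm
    induction m, hm using Nat.le_induction with
    | base => simp
    | succ m hm ih =>
      rw [Finset.sum_Ico_succ_top hm, ih]
      push_cast
      ring
  have hle : (∑ k ∈ Finset.Ico K (n + 1), (k : ℝ)) * f n
      ≤ ∑ k ∈ Finset.Ico K (n + 1), (k : ℝ) * f k := by
    rw [Finset.sum_mul]
    refine Finset.sum_le_sum fun k hk => ?_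
    rw [Finset.mem_Ico] at hk
    rcases Nat.eq_zero_or_pos k with rfl | hk0
    · simp
    · exact mul_le_mul_of_nonneg_left
        (hf (Set.mem_Ici.2 hk0) (Set.mem_Ici.2 (by lia)) (by lia)) k.cast_nonneg
  have htail := hsum.sum_le_tsum (Finset.range (n + 1)) fun k _ => hnn k
  rw [← Finset.sum_range_add_sum_Ico _ hKn] at htail
  rw [hgauss _ hKn] at hle
  push_cast at hle
  have hnK : 2 * (K : ℝ) ≤ n := by exact_mod_cast hn
  have hK0 : (0 : ℝ) ≤ K := K.cast_nonneg
  have hcoef : 3 / 8 * (n : ℝ) ^ 2 ≤ (((n : ℝ) + 1) * (n + 1 - 1) - K * (K - 1)) / 2 := by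
    nlinarith
  have hbound := mul_le_mul_of_nonneg_right hcoef (hf0 n)
  rw [Real.dist_eq, sub_zero, abs_of_nonneg (mul_nonneg (sq_nonneg _) (hf0 n))]
  linarith

/-- Lemma 3.6 of the paper: if `g : ℕ → [0,∞)` is non-increasing and
`Σ_n n·g(n)^s = ∞`, then with `g₁(n) = min{g(n), n^{−2/s}}` we also have
`Σ_n n·g₁(n)^s = ∞`. -/
theorem statement16 (s : ℝ) (hs : 0 < s)
    (g : ℕ → ℝ) (hg0 : ∀ n, 0 ≤ g n) (hganti : ∀ n, 1 ≤ n → g (n + 1) ≤ g n)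
    (hdiv : ¬ Summable fun n : ℕ => (n : ℝ) * g n ^ s) :
    ¬ Summable fun n : ℕ => (n : ℝ) * (min (g n) ((n : ℝ) ^ (-2 / s))) ^ s := by
  intro hsum
  have hmin0 : ∀ n : ℕ, 0 ≤ min (g n) ((n : ℝ) ^ (-2 / s)) := fun n =>
    le_min (hg0 n) (by positivity)
  have hg : AntitoneOn g (Set.Ici 1) := by
    intro m hm n _ hmn
    induction n, hmn using Nat.le_induction with
    | base => exact le_rfl
    | succ n hmn ih =>
      have hn : 1 ≤ n := le_trans hm hmn
      exact (hganti n hn).trans (ih hn)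
  have hanti : AntitoneOn (fun n : ℕ => (min (g n) ((n : ℝ) ^ (-2 / s))) ^ s) (Set.Ici 1) := by
    intro m hm n hn hmn
    have hm0 : (0 : ℝ) < m := Nat.cast_pos.2 hm
    refine Real.rpow_le_rpow (hmin0 n) (min_le_min (hg hm hn hmn) ?_) hs.le
    exact Real.rpow_le_rpow_of_nonpos hm0 (Nat.cast_le.2 hmn)
      (div_nonpos_of_nonpos_of_nonneg (by norm_num) hs.le)
  have hlim := tendsto_sq_mul_of_antitoneOn_of_summable
    (fun n => Real.rpow_nonneg (hmin0 n) s) hanti hsum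
  refine hdiv ((summable_congr_atTop ?_).1 hsum)
  filter_upwards [hlim.eventually (gt_mem_nhds one_pos), Filter.eventually_ge_atTop 1] with n hn hn1
  have hn0 : (0 : ℝ) < n := Nat.cast_pos.2 hn1
  rcases le_total (g n) ((n : ℝ) ^ (-2 / s)) with h | h
  · rw [min_eq_left h]
  · rw [min_eq_right h, ← Real.rpow_mul hn0.le, div_mul_cancel₀ _ hs.ne', ← Real.rpow_natCast,
      ← Real.rpow_add hn0] at hn
    norm_num at hn
end

section
/- Let s > 0 and let g : ℕ → [0,∞) be non-increasing with Σ_{n=1}^∞ n·g(n)^s = ∞. Let g₁(n) := min{g(n), n^{−2/s}} and define g₂ : ℕ → [0,∞) by g₂(n) := g₁(n) if g₁(n) ≥ n^{−4/s}, and g₂(n) := 0 otherwise. Then Σ_{n=1}^∞ n·g₂(n)^s = ∞. -/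
noncomputable section

open Filter

/-- If `k` is nonnegative and non-increasing on the positive integers and `∑ n * k n` converges,
then `n ^ 2 * k n` is eventually smaller than `1`. -/
theorem eventually_sq_mul_lt_one_of_summable {k : ℕ → ℝ} (hk0 : ∀ n, 0 ≤ k n)
    (hk : AntitoneOn k (Set.Ici 1)) (hsum : Summable fun n : ℕ => (n : ℝ) * k n) :
    ∀ᶠ n : ℕ in atTop, (n : ℝ) ^ 2 * k n < 1 := by
  have hS := hsum.hasSum.tendsto_sum_nat
  have hupper : Tendsto (fun n : ℕ => n + 1) atTop atTop := tendsto_add_atTop_nat 1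
  have hlower : Tendsto (fun n : ℕ => n / 2 + 1) atTop atTop :=
    hupper.comp (Nat.tendsto_div_const_atTop two_ne_zero)
  have hdiff := (hS.comp hupper).sub (hS.comp hlower)
  rw [sub_self] at hdiff
  filter_upwards [hdiff.eventually_lt_const (show (0 : ℝ) < 1 / 4 by norm_num)] with n hn
  simp only [Function.comp_apply] at hn
  rw [← Finset.sum_Ico_eq_sub _ (show n / 2 + 1 ≤ n + 1 by omega)] at hn
  have hcard : (Finset.Ico (n / 2 + 1) (n + 1)).card • (((n / 2 + 1 : ℕ) : ℝ) * k n) ≤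
      ∑ j ∈ Finset.Ico (n / 2 + 1) (n + 1), (j : ℝ) * k j := by
    refine Finset.card_nsmul_le_sum _ _ _ fun j hj => ?_
    rw [Finset.mem_Ico] at hj
    have hkj : k n ≤ k j := hk (Set.mem_Ici.2 (by omega)) (Set.mem_Ici.2 (by omega)) (by omega)
    exact mul_le_mul (Nat.cast_le.2 hj.1) hkj (hk0 n) (Nat.cast_nonneg j)
  rw [Nat.card_Ico, nsmul_eq_mul, ← mul_assoc] at hcard
  have hcount : n ^ 2 ≤ 4 * ((n + 1 - (n / 2 + 1)) * (n / 2 + 1)) := by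
    have h₁ : n ≤ 2 * (n + 1 - (n / 2 + 1)) := by omega
    have h₂ : n ≤ 2 * (n / 2 + 1) := by omega
    nlinarith [Nat.mul_le_mul h₁ h₂]
  have hcount' : (n : ℝ) ^ 2 ≤
      4 * (((n + 1 - (n / 2 + 1) : ℕ) : ℝ) * ((n / 2 + 1 : ℕ) : ℝ)) := by
    exact_mod_cast hcount
  linarith [mul_le_mul_of_nonneg_right hcount' (hk0 n)]

/-- For non-increasing `h ≥ 0`, convergence of `∑ n * h n` can be tested on `min (h n) n⁻²`. -/
theorem summable_of_summable_mul_min_inv_sq {h : ℕ → ℝ} (h0 : ∀ n, 0 ≤ h n)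
    (hanti : AntitoneOn h (Set.Ici 1))
    (hsum : Summable fun n : ℕ => (n : ℝ) * min (h n) ((n : ℝ) ^ 2)⁻¹) :
    Summable fun n : ℕ => (n : ℝ) * h n := by
  have hk : AntitoneOn (fun n : ℕ => min (h n) ((n : ℝ) ^ 2)⁻¹) (Set.Ici 1) := by
    intro a ha b hb hab
    have ha' : (0 : ℝ) < a := Nat.cast_pos.2 ha
    have hab' : (a : ℝ) ≤ b := Nat.cast_le.2 hab
    exact min_le_min (hanti ha hb hab) (by gcongr)
  have hev := eventually_sq_mul_lt_one_of_summable (fun n => le_min (h0 n) (by positivity)) hk hsum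
  refine (summable_congr_atTop ?_).1 hsum
  filter_upwards [hev, eventually_ge_atTop 1] with n hn hn1
  have hpos : (0 : ℝ) < n := Nat.cast_pos.2 hn1
  rcases le_total (h n) ((n : ℝ) ^ 2)⁻¹ with hle | hle
  · rw [min_eq_left hle]
  · rw [min_eq_right hle, mul_inv_cancel₀ (by positivity)] at hn
    exact absurd hn (lt_irrefl 1)

/-- Lemma 3.7 of the paper: if `g : ℕ → [0,∞)` is non-increasing and
`Σ_n n·g(n)^s = ∞`, then with `g₁(n) = min{g(n), n^{−2/s}}` and `g₂(n) = g₁(n)` when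
`g₁(n) ≥ n^{−4/s}`, `g₂(n) = 0` otherwise, we also have `Σ_n n·g₂(n)^s = ∞`. -/
theorem statement17 (s : ℝ) (hs : 0 < s)
    (g : ℕ → ℝ) (hg0 : ∀ n, 0 ≤ g n) (hganti : ∀ n, 1 ≤ n → g (n + 1) ≤ g n)
    (hdiv : ¬ Summable fun n : ℕ => (n : ℝ) * g n ^ s) :
    ¬ Summable fun n : ℕ => (n : ℝ) *
      (if (n : ℝ) ^ (-4 / s) ≤ min (g n) ((n : ℝ) ^ (-2 / s)) then
        min (g n) ((n : ℝ) ^ (-2 / s)) else 0) ^ s := by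
  intro hsum
  refine hdiv (summable_of_summable_mul_min_inv_sq (fun n => Real.rpow_nonneg (hg0 n) s) ?_ ?_)
  · intro a ha b _ hab
    refine Real.rpow_le_rpow (hg0 b) ?_ hs.le
    induction b, hab using Nat.le_induction with
    | base => exact le_rfl
    | succ m ham ih =>
      have hm : 1 ≤ m := le_trans ha ham
      exact (hganti m hm).trans (ih hm)
  · have hp : Summable fun n : ℕ => ((n : ℝ) ^ 3)⁻¹ := Real.summable_nat_pow_inv.2 (by norm_num)
    refine Summable.of_nonneg_of_le (fun n => ?_) (fun n => ?_) (hsum.add hp)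
    · exact mul_nonneg n.cast_nonneg (le_min (Real.rpow_nonneg (hg0 n) s) (by positivity))
    rcases n.eq_zero_or_pos with rfl | hn
    · simp
    have hpos : (0 : ℝ) < n := Nat.cast_pos.2 hn
    have hpow (m : ℕ) : ((n : ℝ) ^ (-(m : ℝ) / s)) ^ s = ((n : ℝ) ^ m)⁻¹ := by
      rw [← Real.rpow_mul hpos.le, div_mul_cancel₀ _ hs.ne', Real.rpow_neg hpos.le,
        Real.rpow_natCast]
    have h2 : ((n : ℝ) ^ (-2 / s)) ^ s = ((n : ℝ) ^ 2)⁻¹ := mod_cast hpow 2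
    have h4 : ((n : ℝ) ^ (-4 / s)) ^ s = ((n : ℝ) ^ 4)⁻¹ := mod_cast hpow 4
    have hnonneg : 0 ≤ min (g n) ((n : ℝ) ^ (-2 / s)) := le_min (hg0 n) (by positivity)
    have hmin : min (g n ^ s) ((n : ℝ) ^ 2)⁻¹ = min (g n) ((n : ℝ) ^ (-2 / s)) ^ s := by
      rw [← h2]
      exact ((Real.monotoneOn_rpow_Ici_of_exponent_nonneg hs.le).map_min
        (hg0 n) (Real.rpow_nonneg hpos.le _)).symm
    rw [hmin]
    split_ifs with hif
    · exact le_add_of_nonneg_right (by positivity)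
    · rw [Real.zero_rpow hs.ne', mul_zero, zero_add]
      calc (n : ℝ) * min (g n) ((n : ℝ) ^ (-2 / s)) ^ s
          ≤ n * ((n : ℝ) ^ (-4 / s)) ^ s := by
            gcongr
            exact (not_le.1 hif).le
        _ = ((n : ℝ) ^ 3)⁻¹ := by
            rw [h4]
            field_simp
end
end
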